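/- Let n ≥ 1, let C_n = (4/n)·π^{n/2}/Γ(n/2), and define the log-Sobolev deficit LS(u) = ∬_{S^n×S^n} |u(ω)−u(η)|²/|ω−η|^n dωdη − C_n ∫_{S^n} u² ln(u²|S^n|/‖u‖₂²) dω. For any L²-normalized spherical harmonic Y of degree 2 on S^n, LS(1 + εY) = (8π^{n/2}/(Γ(n/2)(n+2)))·ε² + o(ε²) as ε → 0. -/

import Mathlib

open MeasureTheory Real Filter

noncomputable section

/-- The unit sphere `S^n ⊂ ℝ^{n+1}`. -/
abbrev Sph (n : ℕ) := Metric.sphere (0 : EuclideanSpace ℝ (Fin (n + 1))) 1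

/-- The surface measure `σ` on the unit sphere `S^n ⊂ ℝ^{n+1}`. -/
def sphMeasure (n : ℕ) : Measure (Sph n) :=
  (volume : Measure (EuclideanSpace ℝ (Fin (n + 1)))).toSphere

/-- The sharp log-Sobolev constant `C_n = (4/n)·π^{n/2}/Γ(n/2)`. -/
def Cls (n : ℕ) : ℝ := (4 / (n : ℝ)) * π ^ ((n : ℝ) / 2) / Real.Gamma ((n : ℝ) / 2)

/-- The log-Sobolev deficit
`LS(u) = ∬ |u(ω)−u(η)|²/|ω−η|^n dωdη − C_n ∫ u² ln(u²|S^n|/‖u‖₂²) dω`. -/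
def LSfun (n : ℕ) (u : Sph n → ℝ) : ℝ :=
  (∫ ω : Sph n, ∫ η : Sph n,
      (u ω - u η) ^ 2
        / ‖(ω : EuclideanSpace ℝ (Fin (n + 1))) - (η : EuclideanSpace ℝ (Fin (n + 1)))‖ ^ n
      ∂(sphMeasure n) ∂(sphMeasure n))
  - Cls n * ∫ ω : Sph n,
      (u ω) ^ 2 * Real.log ((u ω) ^ 2 * (sphMeasure n Set.univ).toReal
        / ∫ η : Sph n, (u η) ^ 2 ∂(sphMeasure n)) ∂(sphMeasure n)

/-- `Y : S^n → ℝ` is a spherical harmonic of degree `l`. -/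
def IsSphericalHarmonic {n : ℕ} (l : ℕ) (Y : Sph n → ℝ) : Prop :=
  ∃ P : MvPolynomial (Fin (n + 1)) ℝ,
    P.IsHomogeneous l ∧
    (∑ i : Fin (n + 1), MvPolynomial.pderiv i (MvPolynomial.pderiv i P)) = 0 ∧
    ∀ ω : Sph n, Y ω = MvPolynomial.eval (fun j => (ω : EuclideanSpace ℝ (Fin (n + 1))) j) P


open scoped ENNReal

/-- Polar coordinates for lower integrals. -/
lemma aux_lintegral_polar {E : Type*} [NormedAddCommGroup E] [NormedSpace ℝ E]
    [MeasurableSpace E] [BorelSpace E] [FiniteDimensional ℝ E] [Nontrivial E]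
    (μ : Measure E) [μ.IsAddHaarMeasure] (f : E → ℝ≥0∞) (hf : Measurable f) :
    ∫⁻ x, f x ∂μ = ∫⁻ ω : Metric.sphere (0 : E) 1, (∫⁻ r in Set.Ioi (0 : ℝ),
      ENNReal.ofReal (r ^ (Module.finrank ℝ E - 1)) * f (r • (ω : E))) ∂μ.toSphere := by
  have h1 : ∫⁻ x, f x ∂μ = ∫⁻ x : ({0}ᶜ : Set E), f x ∂(μ.comap (↑)) := by
    rw [lintegral_subtype_comap (measurableSet_singleton _).compl, restrict_compl_singleton]
  rw [h1]
  have hmp := μ.measurePreserving_homeomorphUnitSphereProd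
  have h2 := (hmp.symm (homeomorphUnitSphereProd E).toMeasurableEquiv).lintegral_comp
    (f := fun x : ({0}ᶜ : Set E) => f x) (hf.comp measurable_subtype_coe)
  rw [← h2, lintegral_prod]
  · refine lintegral_congr fun ω => ?_
    rw [Measure.volumeIoiPow, lintegral_withDensity_eq_lintegral_mul]
    · rw [← lintegral_subtype_comap measurableSet_Ioi]
      rfl
    · fun_prop
    · refine hf.comp (measurable_subtype_coe.comp ?_)
      exact (homeomorphUnitSphereProd E).symm.measurable.comp measurable_prodMk_left
  · refine (hf.comp (measurable_subtype_coe.comp ?_)).aemeasurable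
    exact (homeomorphUnitSphereProd E).symm.measurable

/-- Radial functions. -/
lemma aux_lintegral_radial {E : Type*} [NormedAddCommGroup E] [NormedSpace ℝ E]
    [MeasurableSpace E] [BorelSpace E] [FiniteDimensional ℝ E] [Nontrivial E]
    (μ : Measure E) [μ.IsAddHaarMeasure] (f : ℝ → ℝ≥0∞) (hf : Measurable f) :
    ∫⁻ x, f ‖x‖ ∂μ = μ.toSphere Set.univ * ∫⁻ r in Set.Ioi (0 : ℝ),
      ENNReal.ofReal (r ^ (Module.finrank ℝ E - 1)) * f r := by
  rw [aux_lintegral_polar μ (fun x => f ‖x‖) (hf.comp measurable_norm), mul_comm,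
    ← lintegral_const]
  refine lintegral_congr fun ω => ?_
  refine setLIntegral_congr_fun measurableSet_Ioi fun r hr => ?_
  have : ‖(ω : E)‖ = 1 := by simp
  simp [norm_smul, this, abs_of_pos (Set.mem_Ioi.1 hr)]

/-- Zonal integration formula. -/
lemma aux_zonal (n : ℕ) (hn : 1 ≤ n) (g : ℝ → ℝ≥0∞) (hg : Measurable g) :
    ∫⁻ η : Sph n, g ((η : EuclideanSpace ℝ (Fin (n + 1))) 0) ∂(sphMeasure n) =
      (volume : Measure (EuclideanSpace ℝ (Fin n))).toSphere Set.univ *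
        ∫⁻ θ in Set.Ioo 0 π, ENNReal.ofReal (sin θ ^ (n - 1)) * g (cos θ) := by
  have : Nonempty (Fin n) := ⟨⟨0, hn⟩⟩
  let G : ℝ → ℝ≥0∞ := Set.indicator (Set.Iio 1) 1
  have hG : Measurable G := measurable_one.indicator measurableSet_Iio
  let c : ℝ≥0∞ := ∫⁻ r in Set.Ioi (0 : ℝ), ENNReal.ofReal (r ^ n) * G r
  let σ := (volume : Measure (EuclideanSpace ℝ (Fin n))).toSphere Set.univ
  have hc : c = ENNReal.ofReal (1 / (n + 1)) := by
    have : c = ∫⁻ r in Set.Ioo (0 : ℝ) 1, ENNReal.ofReal (r ^ n) := by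
      have h : ∀ r : ℝ, ENNReal.ofReal (r ^ n) * G r =
          (Set.Iio (1 : ℝ)).indicator (fun r => ENNReal.ofReal (r ^ n)) r := by
        intro r
        by_cases hr : r ∈ Set.Iio (1 : ℝ)
        · simp only [G, Set.indicator_of_mem hr]; simp
        · simp only [G, Set.indicator_of_notMem hr]; simp
      simp only [c, h]
      rw [setLIntegral_indicator measurableSet_Iio, Set.inter_comm, Set.Ioi_inter_Iio]
    rw [this, Measure.restrict_congr_set Ioo_ae_eq_Ioc,
      ← ofReal_integral_eq_lintegral_ofReal (intervalIntegral.intervalIntegrable_pow _).1,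
      ← intervalIntegral.integral_of_le zero_le_one]
    · simp
    · filter_upwards [ae_restrict_mem measurableSet_Ioc] with y hy
      exact pow_nonneg hy.1.le _
  have hc0 : c ≠ 0 := by
    rw [hc]; simp only [ne_eq, ENNReal.ofReal_eq_zero, not_le]; positivity
  have hct : c ≠ ⊤ := by rw [hc]; exact ENNReal.ofReal_ne_top
  let h : ℝ → ℝ → ℝ≥0∞ := fun s ρ => G (√(s ^ 2 + ρ ^ 2)) * g (s / √(s ^ 2 + ρ ^ 2))
  have hh : Measurable (Function.uncurry h) := by
    simp only [h, Function.uncurry_def]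
    refine Measurable.mul (hG.comp (by fun_prop)) (hg.comp (by fun_prop))
  let F : EuclideanSpace ℝ (Fin (n + 1)) → ℝ≥0∞ := fun x => G ‖x‖ * g (x 0 / ‖x‖)
  have hF : Measurable F := by
    refine Measurable.mul (hG.comp (by fun_prop)) (hg.comp (by fun_prop))
  have e1 : ∫⁻ x, F x = c * ∫⁻ η : Sph n, g ((η : EuclideanSpace ℝ (Fin (n + 1))) 0)
      ∂(sphMeasure n) := by
    rw [aux_lintegral_polar volume F hF, ← lintegral_const_mul' _ _ hct]
    refine lintegral_congr fun ω => ?_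
    simp only [c]
    rw [← lintegral_mul_const _ (by fun_prop)]
    refine setLIntegral_congr_fun measurableSet_Ioi fun r hr => ?_
    have hω : ‖(ω : EuclideanSpace ℝ (Fin (n + 1)))‖ = 1 := by simp
    have hr' : (0 : ℝ) < r := hr
    simp [F, norm_smul, hω, abs_of_pos hr', hr'.ne', mul_assoc]
  have e2 : ∫⁻ x, F x = ∫⁻ s : ℝ, ∫⁻ y : EuclideanSpace ℝ (Fin n), h s ‖y‖ := by
    have m1 := (EuclideanSpace.volume_preserving_symm_measurableEquiv_toLp (Fin (n + 1))).symm
    rw [← m1.lintegral_comp hF]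
    have m2 := (volume_preserving_piFinSuccAbove (fun _ : Fin (n + 1) => ℝ) 0).symm
    rw [← m2.lintegral_comp (f := fun x => F ((MeasurableEquiv.toLp 2 (Fin (n + 1) → ℝ)).symm.symm x))
      (hF.comp (MeasurableEquiv.measurable _))]
    rw [Measure.volume_eq_prod, lintegral_prod]
    · refine lintegral_congr fun s => ?_
      have m3 := (EuclideanSpace.volume_preserving_symm_measurableEquiv_toLp (Fin n)).symm
      rw [← m3.lintegral_comp (f := fun y => h s ‖y‖) (by
        exact (hh.comp measurable_prodMk_left).comp measurable_norm)]
      refine lintegral_congr fun y => ?_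
      simp [F, h, EuclideanSpace.norm_eq, Fin.sum_univ_succ, Real.sq_sqrt, Finset.sum_nonneg, sq_nonneg]
    · exact ((hF.comp (MeasurableEquiv.measurable _)).comp
        (MeasurableEquiv.measurable _)).aemeasurable
  have e3 : ∫⁻ s : ℝ, ∫⁻ y : EuclideanSpace ℝ (Fin n), h s ‖y‖ =
      σ * ∫⁻ s : ℝ, ∫⁻ ρ : ℝ, (Set.Ioi (0:ℝ)).indicator
        (fun ρ => ENNReal.ofReal (ρ ^ (n - 1)) * h s ρ) ρ := by
    rw [← lintegral_const_mul']
    · refine lintegral_congr fun s => ?_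
      rw [aux_lintegral_radial volume (h s) (hh.comp measurable_prodMk_left),
        lintegral_indicator measurableSet_Ioi]
      simp [σ]
    · exact measure_ne_top _ _
  let H : ℝ × ℝ → ℝ≥0∞ := fun p => (Set.Ioi (0:ℝ)).indicator
        (fun ρ => ENNReal.ofReal (ρ ^ (n - 1)) * h p.1 ρ) p.2
  have hHm : Measurable H := by
    have : H = Set.indicator (Prod.snd ⁻¹' (Set.Ioi (0:ℝ)))
        (fun p : ℝ × ℝ => ENNReal.ofReal (p.2 ^ (n - 1)) * h p.1 p.2) := by
      ext p; simp [H, Set.indicator]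
    rw [this]
    refine Measurable.indicator ?_ (measurable_snd measurableSet_Ioi)
    exact Measurable.mul (by fun_prop) hh
  have e4 : ∫⁻ s : ℝ, ∫⁻ ρ : ℝ, (Set.Ioi (0:ℝ)).indicator
        (fun ρ => ENNReal.ofReal (ρ ^ (n - 1)) * h s ρ) ρ = ∫⁻ p : ℝ × ℝ, H p := by
    rw [Measure.volume_eq_prod, lintegral_prod _ hHm.aemeasurable]
  have e5 : ∫⁻ p : ℝ × ℝ, H p = c * ∫⁻ θ in Set.Ioo 0 π,
      ENNReal.ofReal (sin θ ^ (n - 1)) * g (cos θ) := by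
    rw [← lintegral_comp_polarCoord_symm, polarCoord_target, Measure.volume_eq_prod,
      ← Measure.prod_restrict]
    have : ∀ᵐ p : ℝ × ℝ ∂((volume.restrict (Set.Ioi (0:ℝ))).prod (volume.restrict (Set.Ioo (-π) π))),
        ENNReal.ofReal p.1 • H (polarCoord.symm p) =
        (ENNReal.ofReal (p.1 ^ n) * G p.1) * (Set.Ioo 0 π).indicator
          (fun θ => ENNReal.ofReal (sin θ ^ (n - 1)) * g (cos θ)) p.2 := by
      rw [Measure.prod_restrict]
      filter_upwards [ae_restrict_mem (measurableSet_Ioi.prod measurableSet_Ioo)] with p hp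
      obtain ⟨hp1, hp2⟩ := hp
      have hr : 0 < p.1 := hp1
      have hs : √((p.1 * cos p.2) ^ 2 + (p.1 * sin p.2) ^ 2) = p.1 := by
        rw [show (p.1 * cos p.2) ^ 2 + (p.1 * sin p.2) ^ 2 = p.1 ^ 2 by
          rw [mul_pow, mul_pow, ← mul_add, Real.cos_sq_add_sin_sq, mul_one]]
        exact Real.sqrt_sq hr.le
      by_cases hθ : p.2 ∈ Set.Ioo 0 π
      · have hsin : 0 < sin p.2 := Real.sin_pos_of_mem_Ioo hθ
        have hmem : p.1 * sin p.2 ∈ Set.Ioi (0:ℝ) := mul_pos hr hsin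
        simp only [H, polarCoord_symm_apply, Set.indicator_of_mem hmem, Set.indicator_of_mem hθ, h, hs]
        rw [mul_div_cancel_left₀ _ hr.ne', mul_pow, ENNReal.ofReal_mul (by positivity),
          smul_eq_mul]
        rw [show p.1 ^ n = p.1 * p.1 ^ (n - 1) by rw [← pow_succ', Nat.sub_add_cancel hn],
          ENNReal.ofReal_mul hr.le]
        ring
      · have hsin : sin p.2 ≤ 0 := by
          refine Real.sin_nonpos_of_nonpos_of_neg_pi_le ?_ hp2.1.le
          by_contra hcon
          exact hθ ⟨not_le.1 hcon, hp2.2⟩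
        have hmem : p.1 * sin p.2 ∉ Set.Ioi (0:ℝ) := by
          simp only [Set.mem_Ioi, not_lt]; exact mul_nonpos_of_nonneg_of_nonpos hr.le hsin
        simp only [H, polarCoord_symm_apply, Set.indicator_of_notMem hmem, Set.indicator_of_notMem hθ]
        simp
    rw [lintegral_congr_ae this, lintegral_prod_mul (f := fun r => ENNReal.ofReal (r ^ n) * G r)
      (g := (Set.Ioo 0 π).indicator (fun θ => ENNReal.ofReal (sin θ ^ (n - 1)) * g (cos θ)))]
    · congr 1
      rw [lintegral_indicator measurableSet_Ioo, Measure.restrict_restrict measurableSet_Ioo]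
      congr 2
      rw [Set.inter_eq_left]
      exact Set.Ioo_subset_Ioo_left (by linarith [Real.pi_pos])
    · exact (Measurable.mul (by fun_prop) hG).aemeasurable
    · refine (Measurable.indicator ?_ measurableSet_Ioo).aemeasurable
      exact Measurable.mul (by fun_prop) (hg.comp (by fun_prop))
  have key := e1.symm.trans (e2.trans (e3.trans (by rw [e4, e5])))
  have key2 : c * ∫⁻ η : Sph n, g ((η : EuclideanSpace ℝ (Fin (n + 1))) 0) ∂(sphMeasure n) =
      c * (σ * ∫⁻ θ in Set.Ioo 0 π, ENNReal.ofReal (sin θ ^ (n - 1)) * g (cos θ)) := by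
    rw [key]; ring
  exact (ENNReal.mul_right_inj hc0 hct).1 key2

/-- Euclidean space. -/
abbrev EE (n : ℕ) := EuclideanSpace ℝ (Fin (n + 1))

/-- The action of a linear isometry on the sphere. -/
def rotS {n : ℕ} (L : EE n ≃ₗᵢ[ℝ] EE n) : Sph n ≃ᵐ Sph n where
  toFun ω := ⟨L ω, by simp⟩
  invFun ω := ⟨L.symm ω, by simp⟩
  left_inv ω := by simp
  right_inv ω := by simp
  measurable_toFun := by
    exact (L.continuous.measurable.comp measurable_subtype_coe).subtype_mk
  measurable_invFun := by
    exact (L.symm.continuous.measurable.comp measurable_subtype_coe).subtype_mk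

lemma rotS_coe {n : ℕ} (L : EE n ≃ₗᵢ[ℝ] EE n) (ω : Sph n) : ((rotS L ω : Sph n) : EE n) = L ω := rfl

open scoped Pointwise in
lemma rotS_mp {n : ℕ} (L : EE n ≃ₗᵢ[ℝ] EE n) :
    MeasurePreserving (rotS L) (sphMeasure n) (sphMeasure n) := by
  refine ⟨(rotS L).measurable, ?_⟩
  ext s hs
  rw [Measure.map_apply (rotS L).measurable hs]
  unfold sphMeasure
  rw [Measure.toSphere_apply' _ hs, Measure.toSphere_apply' _ ((rotS L).measurable hs)]
  congr 1
  have hL : MeasurePreserving L.toMeasurableEquiv volume volume := L.measurePreserving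
  rw [← hL.measure_preimage_equiv (Set.Ioo (0 : ℝ) 1 • (Subtype.val '' s))]
  congr 1
  ext x
  simp only [Set.mem_smul, Set.mem_image, Set.mem_preimage]
  constructor
  · rintro ⟨r, hr, _, ⟨ω, hω, rfl⟩, rfl⟩
    exact ⟨r, hr, _, ⟨rotS L ω, hω, rfl⟩, by simp [rotS_coe]⟩
  · rintro ⟨r, hr, _, ⟨ω, hω, rfl⟩, h⟩
    refine ⟨r, hr, _, ⟨(rotS L).symm ω, by simpa using hω, rfl⟩, ?_⟩
    apply L.injective
    rw [L.map_smul, ← rotS_coe, MeasurableEquiv.apply_symm_apply, h]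
    simp

instance (n : ℕ) : IsFiniteMeasure (sphMeasure n) := by unfold sphMeasure; infer_instance

lemma rotS_integral {n : ℕ} (L : EE n ≃ₗᵢ[ℝ] EE n) (f : Sph n → ℝ) :
    ∫ ω, f (rotS L ω) ∂(sphMeasure n) = ∫ ω, f ω ∂(sphMeasure n) :=
  (rotS_mp L).integral_comp (rotS L).measurableEmbedding f

lemma rotS_lintegral {n : ℕ} (L : EE n ≃ₗᵢ[ℝ] EE n) (f : Sph n → ℝ≥0∞) :
    ∫⁻ ω, f (rotS L ω) ∂(sphMeasure n) = ∫⁻ ω, f ω ∂(sphMeasure n) :=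
  (rotS_mp L).lintegral_comp_emb (rotS L).measurableEmbedding f

/-- North pole. -/
def npole (n : ℕ) : Sph n := ⟨EuclideanSpace.single 0 1, by simp⟩

lemma npole_coe (n : ℕ) : (npole n : EE n) = EuclideanSpace.single 0 1 := rfl

lemma exists_rot {n : ℕ} (ω : Sph n) : ∃ L : EE n ≃ₗᵢ[ℝ] EE n, rotS L (npole n) = ω := by
  refine ⟨Submodule.reflection (Submodule.span ℝ {(npole n : EE n) - (ω : EE n)})ᗮ, ?_⟩
  apply Subtype.ext
  rw [rotS_coe]
  exact Submodule.reflection_sub (by simp)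

lemma norm_npole_sub {n : ℕ} (η : Sph n) :
    ‖(npole n : EE n) - (η : EE n)‖ = √(2 - 2 * (η : EE n) 0) := by
  have h : ‖(npole n : EE n) - (η : EE n)‖ ^ 2 = 2 - 2 * (η : EE n) 0 := by
    rw [norm_sub_sq_real, npole_coe, EuclideanSpace.inner_single_left]
    simp
    ring
  rw [← h, Real.sqrt_sq (norm_nonneg _)]

lemma sqrt_half {θ : ℝ} (h : θ ∈ Set.Ioo 0 π) : √(2 - 2 * cos θ) = 2 * sin (θ / 2) := by
  have h1 : 0 < sin (θ / 2) := Real.sin_pos_of_mem_Ioo ⟨by linarith [h.1], by linarith [h.2, h.1]⟩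
  have h2 : 2 - 2 * cos θ = (2 * sin (θ / 2)) ^ 2 := by
    have := Real.cos_two_mul (θ / 2)
    rw [show 2 * (θ / 2) = θ by ring] at this
    rw [this, mul_pow, Real.sin_sq]; ring
  rw [h2, Real.sqrt_sq (by positivity)]

/-- Value of the basic integral. -/
def Jc (n : ℕ) : ℝ := 8 * π ^ ((n : ℝ) / 2) / (Real.Gamma ((n : ℝ) / 2) * ((n : ℝ) + 2))

lemma sphere_area (n : ℕ) (hn : 1 ≤ n) :
    (volume : Measure (EuclideanSpace ℝ (Fin n))).toSphere Set.univ =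
      ENNReal.ofReal (2 * π ^ ((n : ℝ) / 2) / Real.Gamma ((n : ℝ) / 2)) := by
  have : Nonempty (Fin n) := ⟨⟨0, hn⟩⟩
  have hn0 : (0 : ℝ) < n := by exact_mod_cast hn
  rw [Measure.toSphere_apply_univ, EuclideanSpace.volume_ball]
  simp only [finrank_euclideanSpace, Fintype.card_fin, ENNReal.ofReal_one, one_pow, one_mul]
  rw [← ENNReal.ofReal_natCast, ← ENNReal.ofReal_mul hn0.le, Real.Gamma_add_one (by positivity)]
  congr 1
  have h1 : √π ^ n = π ^ ((n : ℝ) / 2) := by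
    rw [Real.sqrt_eq_rpow, ← Real.rpow_mul_natCast Real.pi_pos.le]
    congr 1; ring
  rw [h1]
  have := (Real.Gamma_pos_of_pos (show (0 : ℝ) < n / 2 by positivity)).ne'
  field_simp

lemma J_lintegral (n : ℕ) (hn : 1 ≤ n) :
    ∫⁻ η : Sph n, ENNReal.ofReal ((1 - (η : EE n) 0 ^ 2) / ‖(npole n : EE n) - (η : EE n)‖ ^ n)
      ∂(sphMeasure n) = ENNReal.ofReal (Jc n) := by
  simp_rw [norm_npole_sub]
  rw [aux_zonal n hn (fun t => ENNReal.ofReal ((1 - t ^ 2) / √(2 - 2 * t) ^ n)) (by fun_prop),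
    sphere_area n hn]
  have h1 : ∫⁻ θ in Set.Ioo 0 π, ENNReal.ofReal (sin θ ^ (n - 1)) *
      ENNReal.ofReal ((1 - cos θ ^ 2) / √(2 - 2 * cos θ) ^ n) =
      ∫⁻ θ in Set.Ioo 0 π, ENNReal.ofReal (2 * (sin (θ / 2) * cos (θ / 2) ^ (n + 1))) := by
    refine setLIntegral_congr_fun measurableSet_Ioo fun θ hθ => ?_
    have hs : 0 < sin θ := Real.sin_pos_of_mem_Ioo hθ
    have h1 : 0 < sin (θ / 2) :=
      Real.sin_pos_of_mem_Ioo ⟨by linarith [hθ.1], by linarith [hθ.2, hθ.1]⟩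
    rw [sqrt_half hθ, ← ENNReal.ofReal_mul (by positivity)]
    congr 1
    rw [← Real.sin_sq, ← mul_div_assoc, ← pow_add, show n - 1 + 2 = n + 1 by omega]
    have h2 := Real.sin_two_mul (θ / 2)
    rw [show 2 * (θ / 2) = θ by ring] at h2
    rw [h2, div_eq_iff (by positivity)]
    ring
  rw [h1]
  have h2 : ∫ θ in (0 : ℝ)..π, 2 * (sin (θ / 2) * cos (θ / 2) ^ (n + 1)) = 4 / (n + 2) := by
    have hd : ∀ θ ∈ Set.uIcc 0 π, HasDerivAt (fun θ : ℝ => -(4 / ((n : ℝ) + 2)) * cos (θ / 2) ^ (n + 2))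
        (2 * (sin (θ / 2) * cos (θ / 2) ^ (n + 1))) θ := by
      intro θ _
      have := (((Real.hasDerivAt_cos (θ / 2)).comp θ ((hasDerivAt_id θ).div_const 2)).pow
        (n + 2)).const_mul (-(4 / ((n : ℝ) + 2)))
      refine HasDerivAt.congr_deriv (f := fun θ : ℝ => -(4 / ((n : ℝ) + 2)) * cos (θ / 2) ^ (n + 2))
        this ?_
      simp only [Function.comp, id, Nat.cast_add, Nat.cast_ofNat, show n + 2 - 1 = n + 1 by omega]
      field_simp
      ring
    rw [intervalIntegral.integral_eq_sub_of_hasDerivAt hd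
      (Continuous.intervalIntegrable (by fun_prop) _ _)]
    simp
  rw [Measure.restrict_congr_set Ioo_ae_eq_Ioc, ← ofReal_integral_eq_lintegral_ofReal,
    ← intervalIntegral.integral_of_le Real.pi_pos.le, h2, ← ENNReal.ofReal_mul]
  · congr 1
    unfold Jc
    field_simp
    norm_num
  · have := Real.Gamma_pos_of_pos (show (0 : ℝ) < n / 2 by have : (0:ℝ) < n := by exact_mod_cast hn
                                                           positivity)
    positivity
  · exact (Continuous.intervalIntegrable (by fun_prop) 0 π).1
  · filter_upwards [ae_restrict_mem measurableSet_Ioc] with θ hθ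
    have h1 : 0 ≤ sin (θ / 2) := Real.sin_nonneg_of_mem_Icc
      ⟨by linarith [hθ.1], by linarith [hθ.2, hθ.1]⟩
    have h2 : 0 ≤ cos (θ / 2) := Real.cos_nonneg_of_mem_Icc
      ⟨by linarith [hθ.1, Real.pi_pos], by linarith [hθ.2, hθ.1]⟩
    simp only [Pi.zero_apply]; positivity

/-- The weakly singular kernel. -/
def kk {n : ℕ} (ω η : Sph n) : ℝ := ‖(ω : EE n) - (η : EE n)‖ / ‖(ω : EE n) - (η : EE n)‖ ^ n

lemma kk_nonneg {n : ℕ} (ω η : Sph n) : 0 ≤ kk ω η := by unfold kk; positivity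

lemma kk_pole (n : ℕ) (hn : 1 ≤ n) :
    ∫⁻ η : Sph n, ENNReal.ofReal (kk (npole n) η) ∂(sphMeasure n) < ⊤ := by
  simp_rw [kk, norm_npole_sub]
  rw [aux_zonal n hn (fun t => ENNReal.ofReal (√(2 - 2 * t) / √(2 - 2 * t) ^ n)) (by fun_prop)]
  refine ENNReal.mul_lt_top (measure_lt_top _ _) ?_
  calc _ ≤ ∫⁻ θ in Set.Ioo 0 π, (1 : ℝ≥0∞) := by
        refine setLIntegral_mono' measurableSet_Ioo fun θ hθ => ?_
        have hs : 0 < sin θ := Real.sin_pos_of_mem_Ioo hθ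
        have h1 : 0 < sin (θ / 2) :=
          Real.sin_pos_of_mem_Ioo ⟨by linarith [hθ.1], by linarith [hθ.2, hθ.1]⟩
        have h3 : 0 ≤ cos (θ / 2) := Real.cos_nonneg_of_mem_Icc
          ⟨by linarith [hθ.1, Real.pi_pos], by linarith [hθ.2, hθ.1]⟩
        rw [sqrt_half hθ, ← ENNReal.ofReal_mul (by positivity), ← ENNReal.ofReal_one]
        apply ENNReal.ofReal_le_ofReal
        have h2 := Real.sin_two_mul (θ / 2)
        rw [show 2 * (θ / 2) = θ by ring] at h2
        obtain ⟨m, rfl⟩ : ∃ m, n = m + 1 := ⟨n - 1, by omega⟩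
        rw [h2, ← mul_div_assoc, div_le_one (by positivity), Nat.add_sub_cancel, mul_pow, pow_succ]
        have : cos (θ / 2) ^ m ≤ 1 := pow_le_one₀ h3 (Real.cos_le_one _)
        calc _ = ((2 * sin (θ / 2)) ^ m * (2 * sin (θ / 2))) * cos (θ / 2) ^ m := by ring
          _ ≤ _ := mul_le_of_le_one_right (by positivity) this
    _ < ⊤ := by simp

lemma kk_rot {n : ℕ} (L : EE n ≃ₗᵢ[ℝ] EE n) (ω η : Sph n) :
    kk (rotS L ω) (rotS L η) = kk ω η := by
  simp only [kk, rotS_coe, ← map_sub, LinearIsometryEquiv.norm_map]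

lemma kk_lintegral (n : ℕ) (ω : Sph n) :
    ∫⁻ η : Sph n, ENNReal.ofReal (kk ω η) ∂(sphMeasure n) =
    ∫⁻ η : Sph n, ENNReal.ofReal (kk (npole n) η) ∂(sphMeasure n) := by
  obtain ⟨L, rfl⟩ := exists_rot ω
  rw [← rotS_lintegral L]
  simp_rw [kk_rot]

lemma kk_measurable (n : ℕ) : Measurable (fun p : Sph n × Sph n => kk p.1 p.2) := by
  unfold kk
  fun_prop

lemma kk_integrable_prod (n : ℕ) (hn : 1 ≤ n) :
    Integrable (fun p : Sph n × Sph n => kk p.1 p.2) ((sphMeasure n).prod (sphMeasure n)) := by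
  refine ⟨(kk_measurable n).aestronglyMeasurable, ?_⟩
  rw [hasFiniteIntegral_iff_ofReal (Eventually.of_forall fun p => kk_nonneg _ _),
    lintegral_prod _ (kk_measurable n).ennreal_ofReal.aemeasurable]
  simp only [kk_lintegral, lintegral_const]
  exact ENNReal.mul_lt_top (kk_pole n hn) (measure_lt_top _ _)

lemma kk_integrable (n : ℕ) (hn : 1 ≤ n) (ω : Sph n) :
    Integrable (fun η : Sph n => kk ω η) (sphMeasure n) := by
  refine ⟨((kk_measurable n).comp measurable_prodMk_left).aestronglyMeasurable, ?_⟩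
  rw [hasFiniteIntegral_iff_ofReal (Eventually.of_forall fun p => kk_nonneg _ _), kk_lintegral]
  exact kk_pole n hn

/-- Elementary degree-two differences divided by the kernel. -/
def pp {n : ℕ} (i j : Fin (n + 1)) (ω η : Sph n) : ℝ :=
  ((ω : EE n) i * (ω : EE n) j - (η : EE n) i * (η : EE n) j) / ‖(ω : EE n) - (η : EE n)‖ ^ n

lemma abs_coord_le {n : ℕ} (x : EE n) (i : Fin (n + 1)) : |x i| ≤ ‖x‖ := by
  simpa using PiLp.norm_apply_le x i

lemma abs_pp_le {n : ℕ} (i j : Fin (n + 1)) (ω η : Sph n) : |pp i j ω η| ≤ 2 * kk ω η := by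
  unfold pp kk
  rw [abs_div, abs_of_nonneg (a := ‖(ω : EE n) - (η : EE n)‖ ^ n) (by positivity), ← mul_div_assoc]
  gcongr
  have h1 := abs_coord_le ((ω : EE n) - (η : EE n)) i
  have h2 := abs_coord_le ((ω : EE n) - (η : EE n)) j
  have h3 : |(ω : EE n) j| ≤ 1 := by simpa using abs_coord_le (ω : EE n) j
  have h4 : |(η : EE n) i| ≤ 1 := by simpa using abs_coord_le (η : EE n) i
  simp only [PiLp.sub_apply] at h1 h2
  calc |(ω : EE n) i * (ω : EE n) j - (η : EE n) i * (η : EE n) j|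
      = |((ω : EE n) i - (η : EE n) i) * (ω : EE n) j
          + (η : EE n) i * ((ω : EE n) j - (η : EE n) j)| := by ring_nf
    _ ≤ |(ω : EE n) i - (η : EE n) i| * |(ω : EE n) j|
          + |(η : EE n) i| * |(ω : EE n) j - (η : EE n) j| := by
        rw [← abs_mul, ← abs_mul]; exact abs_add_le _ _
    _ ≤ ‖(ω : EE n) - (η : EE n)‖ * 1 + 1 * ‖(ω : EE n) - (η : EE n)‖ := by gcongr
    _ = _ := by ring

lemma pp_measurable {n : ℕ} (i j : Fin (n + 1)) :
    Measurable (fun p : Sph n × Sph n => pp i j p.1 p.2) := by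
  unfold pp
  fun_prop

lemma pp_integrable_prod {n : ℕ} (hn : 1 ≤ n) (i j : Fin (n + 1)) :
    Integrable (fun p : Sph n × Sph n => pp i j p.1 p.2) ((sphMeasure n).prod (sphMeasure n)) :=
  ((kk_integrable_prod n hn).const_mul 2).mono' (pp_measurable i j).aestronglyMeasurable
    (Eventually.of_forall fun p => abs_pp_le i j p.1 p.2)

lemma pp_integrable {n : ℕ} (hn : 1 ≤ n) (i j : Fin (n + 1)) (ω : Sph n) :
    Integrable (fun η : Sph n => pp i j ω η) (sphMeasure n) :=
  ((kk_integrable n hn ω).const_mul 2).mono'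
    ((pp_measurable i j).comp measurable_prodMk_left).aestronglyMeasurable
    (Eventually.of_forall fun η => abs_pp_le i j ω η)

/-- Moments at the pole. -/
def mm (n : ℕ) (i j : Fin (n + 1)) : ℝ := ∫ η : Sph n, pp i j (npole n) η ∂(sphMeasure n)

lemma mm_comm (n : ℕ) (i j : Fin (n + 1)) : mm n i j = mm n j i := by
  unfold mm pp
  simp only [mul_comm]

/-- Sign flip of one coordinate. -/
def flipL {n : ℕ} (i : Fin (n + 1)) : EE n ≃ₗᵢ[ℝ] EE n :=
  LinearIsometryEquiv.piLpCongrRight 2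
    (fun k => if k = i then LinearIsometryEquiv.neg ℝ else LinearIsometryEquiv.refl ℝ ℝ)

lemma flipL_apply {n : ℕ} (i k : Fin (n + 1)) (x : EE n) :
    flipL i x k = if k = i then - x k else x k := by
  simp only [flipL, LinearIsometryEquiv.piLpCongrRight_apply]
  split_ifs with h <;> simp [h]

/-- Swap of two coordinates. -/
def swapL {n : ℕ} (i j : Fin (n + 1)) : EE n ≃ₗᵢ[ℝ] EE n :=
  LinearIsometryEquiv.piLpCongrLeft 2 ℝ ℝ (Equiv.swap i j)

lemma swapL_apply {n : ℕ} (i j k : Fin (n + 1)) (x : EE n) :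
    swapL i j x k = x (Equiv.swap i j k) := by
  simp [swapL, LinearIsometryEquiv.piLpCongrLeft_apply, Equiv.piCongrLeft'_apply]

lemma flip_pole {n : ℕ} (i : Fin (n + 1)) (hi : i ≠ 0) : flipL i (npole n : EE n) = npole n := by
  ext k
  rw [flipL_apply]
  split_ifs with h
  · subst h; simp [npole_coe, hi]
  · rfl

lemma swap_pole {n : ℕ} (i j : Fin (n + 1)) (hi : i ≠ 0) (hj : j ≠ 0) :
    swapL i j (npole n : EE n) = npole n := by
  ext k
  rw [swapL_apply, npole_coe]
  by_cases h : k = 0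
  · subst h; rw [Equiv.swap_apply_of_ne_of_ne hi.symm hj.symm]
  · have : Equiv.swap i j k ≠ 0 := by
      intro h2
      apply h
      rw [Equiv.swap_apply_eq_iff, Equiv.swap_apply_of_ne_of_ne hi.symm hj.symm] at h2
      exact h2
    simp [h, this]

lemma mm_off (n : ℕ) (i j : Fin (n + 1)) (hi : i ≠ 0) (hij : j ≠ i) : mm n i j = 0 := by
  have h : mm n i j = - mm n i j := by
    conv_lhs => rw [mm, ← rotS_integral (flipL i)]
    rw [mm, ← integral_neg]
    congr 1
    ext η
    unfold pp
    have h1 : ‖(npole n : EE n) - flipL i (η : EE n)‖ = ‖(npole n : EE n) - (η : EE n)‖ := by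
      conv_lhs => rw [← flip_pole i hi, ← map_sub, LinearIsometryEquiv.norm_map]
    rw [rotS_coe, h1, flipL_apply, flipL_apply, if_pos rfl, if_neg hij, ← neg_div]
    congr 1
    have : (npole n : EE n) i = 0 := by simp [npole_coe, hi]
    rw [this]; ring
  linarith

lemma mm_swap (n : ℕ) (i j : Fin (n + 1)) (hi : i ≠ 0) (hj : j ≠ 0) : mm n i i = mm n j j := by
  conv_lhs => rw [mm, ← rotS_integral (swapL i j)]
  rw [mm]
  congr 1
  ext η
  unfold pp
  have h1 : ‖(npole n : EE n) - swapL i j (η : EE n)‖ = ‖(npole n : EE n) - (η : EE n)‖ := by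
    conv_lhs => rw [← swap_pole i j hi hj, ← map_sub, LinearIsometryEquiv.norm_map]
  rw [rotS_coe, h1, swapL_apply, Equiv.swap_apply_left]
  simp [npole_coe, hi, hj]

lemma sphere_sum {n : ℕ} (ω : Sph n) : ∑ i, (ω : EE n) i * (ω : EE n) i = 1 := by
  have h : ‖(ω : EE n)‖ ^ 2 = 1 := by simp
  rw [EuclideanSpace.norm_sq_eq] at h
  rw [← h]
  refine Finset.sum_congr rfl fun i _ => ?_
  rw [Real.norm_eq_abs, sq_abs, sq]

lemma mm_sum (n : ℕ) (hn : 1 ≤ n) : ∑ i, mm n i i = 0 := by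
  unfold mm
  rw [← integral_finsetSum _ fun i _ => pp_integrable hn i i _]
  have : ∀ η : Sph n, ∑ i, pp i i (npole n) η = 0 := by
    intro η
    unfold pp
    rw [← Finset.sum_div, Finset.sum_sub_distrib, sphere_sum, sphere_sum]
    simp
  simp [this]

lemma Jc_pos (n : ℕ) (hn : 1 ≤ n) : 0 < Jc n := by
  have hn0 : (0 : ℝ) < n := by exact_mod_cast hn
  have := Real.Gamma_pos_of_pos (show (0 : ℝ) < n / 2 by positivity)
  unfold Jc; positivity

lemma mm_zero (n : ℕ) (hn : 1 ≤ n) : mm n 0 0 = Jc n := by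
  have h : ∀ η : Sph n, pp 0 0 (npole n) η =
      (1 - (η : EE n) 0 ^ 2) / ‖(npole n : EE n) - (η : EE n)‖ ^ n := by
    intro η
    unfold pp
    congr 1
    simp [npole_coe, sq]
  rw [mm, integral_eq_lintegral_of_nonneg_ae]
  · simp_rw [h]
    rw [J_lintegral n hn, ENNReal.toReal_ofReal (Jc_pos n hn).le]
  · refine Eventually.of_forall fun η => ?_
    simp only [h, Pi.zero_apply]
    have h4 : |(η : EE n) 0| ≤ 1 := by simpa using abs_coord_le (η : EE n) 0
    have : (η : EE n) 0 ^ 2 ≤ 1 := by rw [← sq_abs]; exact pow_le_one₀ (abs_nonneg _) h4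
    have : 0 ≤ 1 - (η : EE n) 0 ^ 2 := by linarith
    positivity
  · exact (pp_integrable hn 0 0 _).1

lemma mm_diag (n : ℕ) (hn : 1 ≤ n) (i : Fin (n + 1)) (hi : i ≠ 0) : mm n i i = - Jc n / n := by
  have h := mm_sum n hn
  rw [Fin.sum_univ_succ, mm_zero n hn] at h
  have h2 : ∑ k : Fin n, mm n k.succ k.succ = n * mm n i i := by
    rw [Finset.sum_congr rfl fun k _ => mm_swap n k.succ i (Fin.succ_ne_zero k) hi]
    simp
  rw [h2] at h
  have hn0 : (n : ℝ) ≠ 0 := by positivity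
  field_simp
  linarith

/-- Quadratic form. -/
def QQ {n : ℕ} (c : Fin (n + 1) → Fin (n + 1) → ℝ) (x : EE n) : ℝ := ∑ i, ∑ j, c i j * (x i * x j)

lemma QQ_diff {n : ℕ} (c : Fin (n + 1) → Fin (n + 1) → ℝ) (ω η : Sph n) :
    (QQ c (ω : EE n) - QQ c (η : EE n)) / ‖(ω : EE n) - (η : EE n)‖ ^ n =
      ∑ i, ∑ j, c i j * pp i j ω η := by
  unfold QQ pp
  rw [← Finset.sum_sub_distrib, Finset.sum_div]
  refine Finset.sum_congr rfl fun i _ => ?_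
  rw [← Finset.sum_sub_distrib, Finset.sum_div]
  refine Finset.sum_congr rfl fun j _ => ?_
  ring

lemma QQ_int_prod {n : ℕ} (hn : 1 ≤ n) (c : Fin (n + 1) → Fin (n + 1) → ℝ) :
    Integrable (fun p : Sph n × Sph n => (QQ c (p.1 : EE n) - QQ c (p.2 : EE n)) /
      ‖(p.1 : EE n) - (p.2 : EE n)‖ ^ n) ((sphMeasure n).prod (sphMeasure n)) := by
  simp_rw [QQ_diff]
  exact integrable_finsetSum _ fun i _ => integrable_finsetSum _ fun j _ =>
    (pp_integrable_prod hn i j).const_mul _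

lemma QQ_int {n : ℕ} (hn : 1 ≤ n) (c : Fin (n + 1) → Fin (n + 1) → ℝ) (ω : Sph n) :
    Integrable (fun η : Sph n => (QQ c (ω : EE n) - QQ c (η : EE n)) /
      ‖(ω : EE n) - (η : EE n)‖ ^ n) (sphMeasure n) := by
  simp_rw [QQ_diff]
  exact integrable_finsetSum _ fun i _ => integrable_finsetSum _ fun j _ =>
    (pp_integrable hn i j ω).const_mul _

/-- The eigenvalue. -/
def lam (n : ℕ) : ℝ := (1 + 1 / (n : ℝ)) * Jc n

lemma eigen_pole {n : ℕ} (hn : 1 ≤ n) (c : Fin (n + 1) → Fin (n + 1) → ℝ)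
    (hc : ∑ i, c i i = 0) :
    ∫ η : Sph n, (QQ c (npole n : EE n) - QQ c (η : EE n)) /
      ‖(npole n : EE n) - (η : EE n)‖ ^ n ∂(sphMeasure n) = lam n * QQ c (npole n : EE n) := by
  simp_rw [QQ_diff]
  rw [integral_finsetSum _ fun i _ => integrable_finsetSum _ fun j _ =>
    (pp_integrable hn i j _).const_mul _]
  have h1 : ∀ i, ∫ η : Sph n, ∑ j, c i j * pp i j (npole n) η ∂(sphMeasure n) =
      c i i * mm n i i := by
    intro i
    rw [integral_finsetSum _ fun j _ => (pp_integrable hn i j _).const_mul _]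
    simp_rw [integral_const_mul]
    rw [Finset.sum_eq_single i]
    · rfl
    · intro j _ hj
      have : mm n i j = 0 := by
        by_cases hi : i = 0
        · rw [mm_comm]
          exact mm_off n j i (by rw [← hi]; exact hj) hj.symm
        · exact mm_off n i j hi hj
      rw [mm] at this
      rw [this, mul_zero]
    · simp
  simp_rw [h1]
  have h2 : QQ c (npole n : EE n) = c 0 0 := by
    unfold QQ
    rw [Finset.sum_eq_single 0, Finset.sum_eq_single 0]
    · simp [npole_coe]
    · intro j _ hj; simp [npole_coe, hj]
    · simp
    · intro j _ hj; simp [npole_coe, hj]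
    · simp
  rw [h2, Fin.sum_univ_succ, mm_zero n hn,
    Finset.sum_congr rfl fun k _ => by rw [mm_diag n hn _ (Fin.succ_ne_zero k)], ← Finset.sum_mul]
  rw [Fin.sum_univ_succ] at hc
  have : ∑ i : Fin n, c i.succ i.succ = - c 0 0 := by linarith
  rw [this]
  unfold lam
  ring

lemma eigen {n : ℕ} (hn : 1 ≤ n) (c : Fin (n + 1) → Fin (n + 1) → ℝ)
    (hc : ∑ i, c i i = 0) (ω : Sph n) :
    ∫ η : Sph n, (QQ c (ω : EE n) - QQ c (η : EE n)) /
      ‖(ω : EE n) - (η : EE n)‖ ^ n ∂(sphMeasure n) = lam n * QQ c (ω : EE n) := by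
  obtain ⟨L, rfl⟩ := exists_rot ω
  rw [← rotS_integral L]
  let a : Fin (n + 1) → Fin (n + 1) → ℝ := fun i k => L.symm (EuclideanSpace.single i 1) k
  let c' : Fin (n + 1) → Fin (n + 1) → ℝ := fun k l => ∑ i, ∑ j, c i j * (a i k * a j l)
  have hL : ∀ (x : EE n) i, L x i = ∑ k, a i k * x k := by
    intro x i
    have h1 : L x i = inner ℝ (EuclideanSpace.single i (1 : ℝ)) (L x) := by
      rw [EuclideanSpace.inner_single_left]; simp
    have h2 : inner ℝ (EuclideanSpace.single i (1 : ℝ)) (L x) =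
        inner ℝ (L.symm (EuclideanSpace.single i (1 : ℝ))) x := by
      conv_rhs => rw [← L.inner_map_map, L.apply_symm_apply]
    rw [h1, h2, PiLp.inner_apply]
    refine Finset.sum_congr rfl fun k _ => ?_
    simp [a, mul_comm]
  have ha : ∀ i j, ∑ k, a i k * a j k = if i = j then 1 else 0 := by
    intro i j
    have h2 : inner ℝ (L.symm (EuclideanSpace.single i (1 : ℝ)))
        (L.symm (EuclideanSpace.single j (1 : ℝ))) = if i = j then (1:ℝ) else 0 := by
      rw [LinearIsometryEquiv.inner_map_map, EuclideanSpace.inner_single_left]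
      simp
    rw [← h2, PiLp.inner_apply]
    refine Finset.sum_congr rfl fun k _ => ?_
    simp [a, mul_comm]
  have hQ : ∀ x : EE n, QQ c (L x) = QQ c' x := by
    intro x
    have e1 : QQ c (L x) = ∑ i, ∑ j, ∑ k, ∑ l, c i j * (a i k * a j l) * (x k * x l) := by
      unfold QQ
      refine Finset.sum_congr rfl fun i _ => Finset.sum_congr rfl fun j _ => ?_
      rw [hL, hL, Finset.sum_mul_sum, Finset.mul_sum]
      refine Finset.sum_congr rfl fun k _ => ?_
      rw [Finset.mul_sum]
      exact Finset.sum_congr rfl fun l _ => by ring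
    have e2 : QQ c' x = ∑ k, ∑ l, ∑ i, ∑ j, c i j * (a i k * a j l) * (x k * x l) := by
      unfold QQ
      simp only [c', Finset.sum_mul]
    rw [e1, e2]
    rw [Finset.sum_congr rfl fun i _ => Finset.sum_comm, Finset.sum_comm]
    refine Finset.sum_congr rfl fun k _ => ?_
    rw [Finset.sum_congr rfl fun i _ => Finset.sum_comm, Finset.sum_comm]
  have hc' : ∑ k, c' k k = 0 := by
    simp only [c']
    rw [Finset.sum_comm]
    rw [← hc]
    refine Finset.sum_congr rfl fun i _ => ?_
    rw [Finset.sum_comm]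
    simp_rw [← Finset.mul_sum, ha]
    simp
  have := eigen_pole hn c' hc'
  simp only [rotS_coe, ← map_sub, LinearIsometryEquiv.norm_map, hQ]
  exact this

lemma poly_QQ {n : ℕ} (P : MvPolynomial (Fin (n + 1)) ℝ) (hP : P.IsHomogeneous 2)
    (hl : (∑ i : Fin (n + 1), MvPolynomial.pderiv i (MvPolynomial.pderiv i P)) = 0) :
    ∃ c : Fin (n + 1) → Fin (n + 1) → ℝ, ∑ i, c i i = 0 ∧
      ∀ x : EE n, MvPolynomial.eval (fun j => x j) P = QQ c x := by
  have h1 : ∀ i, (MvPolynomial.pderiv i P).IsHomogeneous 1 := fun i => hP.pderiv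
  have h2 : ∀ i j, (MvPolynomial.pderiv j (MvPolynomial.pderiv i P)).IsHomogeneous 0 :=
    fun i j => (h1 i).pderiv
  have h3 : ∀ i j, ∃ r : ℝ, MvPolynomial.pderiv j (MvPolynomial.pderiv i P) =
      MvPolynomial.C r := by
    intro i j
    have := MvPolynomial.totalDegree_eq_zero_iff_eq_C.1
      (Nat.le_zero.1 (h2 i j).totalDegree_le)
    exact ⟨_, this⟩
  choose r hr using h3
  refine ⟨fun i j => r i j / 2, ?_, ?_⟩
  · rw [← Finset.sum_div]
    simp_rw [hr, ← map_sum] at hl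
    rw [MvPolynomial.C_eq_zero.1 hl, zero_div]
  · intro x
    have e1 := congrArg (MvPolynomial.eval (fun j => x j)) hP.sum_X_mul_pderiv
    have e2 := fun i => congrArg (MvPolynomial.eval (fun j => x j)) (h1 i).sum_X_mul_pderiv
    simp only [map_sum, map_mul, MvPolynomial.eval_X, hr, MvPolynomial.eval_C, map_nsmul,
      one_smul] at e1 e2
    simp_rw [← e2] at e1
    have e3 : MvPolynomial.eval (fun j => x j) P =
      (∑ i, x i * ∑ j, x j * r i j) / 2 := by
      rw [e1]; simp
    rw [e3, QQ, Finset.sum_div]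
    refine Finset.sum_congr rfl fun i _ => ?_
    rw [Finset.mul_sum, Finset.sum_div]
    exact Finset.sum_congr rfl fun j _ => by ring

lemma QQ_cont {n : ℕ} (c : Fin (n + 1) → Fin (n + 1) → ℝ) :
    Continuous (fun ω : Sph n => QQ c (ω : EE n)) := by
  unfold QQ
  fun_prop

lemma QQ_bdd {n : ℕ} (c : Fin (n + 1) → Fin (n + 1) → ℝ) :
    ∃ B : ℝ, 0 < B ∧ ∀ ω : Sph n, |QQ c (ω : EE n)| ≤ B := by
  obtain ⟨B, hB⟩ := isCompact_univ.exists_bound_of_continuousOn (QQ_cont c).continuousOn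
  exact ⟨max B 1, by positivity, fun ω => (hB ω trivial).trans (le_max_left _ _)⟩

lemma sph_integrable {n : ℕ} {f : Sph n → ℝ} (hf : Continuous f) :
    Integrable f (sphMeasure n) := by
  rw [← integrableOn_univ]
  exact hf.continuousOn.integrableOn_compact isCompact_univ

lemma QQ_mean {n : ℕ} (hn : 1 ≤ n) (c : Fin (n + 1) → Fin (n + 1) → ℝ)
    (hc : ∑ i, c i i = 0) : ∫ ω : Sph n, QQ c (ω : EE n) ∂(sphMeasure n) = 0 := by
  have h1 := integral_integral_swap (f := fun ω η : Sph n => (QQ c (ω : EE n) - QQ c (η : EE n)) /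
      ‖(ω : EE n) - (η : EE n)‖ ^ n) (QQ_int_prod hn c)
  have h2 : ∀ η ω : Sph n, (QQ c (ω : EE n) - QQ c (η : EE n)) / ‖(ω : EE n) - (η : EE n)‖ ^ n =
      - ((QQ c (η : EE n) - QQ c (ω : EE n)) / ‖(η : EE n) - (ω : EE n)‖ ^ n) := by
    intro η ω
    rw [norm_sub_rev, ← neg_div, neg_sub]
  have h3 : ∀ η : Sph n, ∫ ω : Sph n, (QQ c (ω : EE n) - QQ c (η : EE n)) /
      ‖(ω : EE n) - (η : EE n)‖ ^ n ∂(sphMeasure n) = - (lam n * QQ c (η : EE n)) := by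
    intro η
    rw [integral_congr_ae (Eventually.of_forall (h2 η)), integral_neg, eigen hn c hc]
  simp_rw [h3, eigen hn c hc] at h1
  rw [integral_neg, integral_const_mul] at h1
  have h4 : lam n ≠ 0 := by
    have := Jc_pos n hn
    unfold lam; positivity
  have : lam n * ∫ ω : Sph n, QQ c (ω : EE n) ∂(sphMeasure n) = 0 := by linarith
  exact (mul_eq_zero.1 this).resolve_left h4

lemma QQ_energy {n : ℕ} (hn : 1 ≤ n) (c : Fin (n + 1) → Fin (n + 1) → ℝ)
    (hc : ∑ i, c i i = 0) :
    ∫ ω : Sph n, ∫ η : Sph n, (QQ c (ω : EE n) - QQ c (η : EE n)) ^ 2 /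
      ‖(ω : EE n) - (η : EE n)‖ ^ n ∂(sphMeasure n) ∂(sphMeasure n) =
      2 * lam n * ∫ ω : Sph n, QQ c (ω : EE n) ^ 2 ∂(sphMeasure n) := by
  obtain ⟨B, hB0, hB⟩ := QQ_bdd c
  let D : Sph n → Sph n → ℝ := fun ω η => (QQ c (ω : EE n) - QQ c (η : EE n)) /
      ‖(ω : EE n) - (η : EE n)‖ ^ n
  have hD : ∀ ω, ∫ η, D ω η ∂(sphMeasure n) = lam n * QQ c (ω : EE n) := eigen hn c hc
  have hDs : ∀ ω η, D ω η = - D η ω := by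
    intro ω η
    simp only [D]
    rw [norm_sub_rev, ← neg_div, neg_sub]
  have hI : Integrable (fun p : Sph n × Sph n => QQ c (p.2 : EE n) * D p.1 p.2)
      ((sphMeasure n).prod (sphMeasure n)) := by
    refine (QQ_int_prod hn c).bdd_mul (c := B) ?_ (Eventually.of_forall fun p => hB p.2)
    exact ((QQ_cont c).comp continuous_snd).aestronglyMeasurable
  have hI1 : ∀ ω : Sph n, Integrable (fun η : Sph n => QQ c (η : EE n) * D ω η) (sphMeasure n) := by
    intro ω
    exact (QQ_int hn c ω).bdd_mul (c := B) (QQ_cont c).aestronglyMeasurable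
      (Eventually.of_forall fun p => hB p)
  have h1 : ∀ ω : Sph n, ∫ η : Sph n, (QQ c (ω : EE n) - QQ c (η : EE n)) ^ 2 /
      ‖(ω : EE n) - (η : EE n)‖ ^ n ∂(sphMeasure n) =
      lam n * QQ c (ω : EE n) ^ 2 - ∫ η : Sph n, QQ c (η : EE n) * D ω η ∂(sphMeasure n) := by
    intro ω
    have : ∀ η : Sph n, (QQ c (ω : EE n) - QQ c (η : EE n)) ^ 2 / ‖(ω : EE n) - (η : EE n)‖ ^ n =
        QQ c (ω : EE n) * D ω η - QQ c (η : EE n) * D ω η := by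
      intro η; simp only [D]; ring
    simp_rw [this]
    rw [integral_sub ((QQ_int hn c ω).const_mul _) (hI1 ω), integral_const_mul, hD]
    ring
  simp_rw [h1]
  have iA : Integrable (fun ω : Sph n => lam n * QQ c (ω : EE n) ^ 2) (sphMeasure n) :=
    (sph_integrable ((QQ_cont c).pow 2)).const_mul _
  have iB : Integrable (fun ω : Sph n => ∫ η : Sph n, QQ c (η : EE n) * D ω η ∂(sphMeasure n))
    (sphMeasure n) := hI.integral_prod_left
  have hsw : ∫ ω : Sph n, ∫ η : Sph n, QQ c (η : EE n) * D ω η ∂(sphMeasure n) ∂(sphMeasure n) =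
      ∫ η : Sph n, ∫ ω : Sph n, QQ c (η : EE n) * D ω η ∂(sphMeasure n) ∂(sphMeasure n) :=
    integral_integral_swap hI
  rw [integral_sub iA iB, hsw, integral_const_mul]
  have h2 : ∀ η : Sph n, ∫ ω : Sph n, QQ c (η : EE n) * D ω η ∂(sphMeasure n) =
      - lam n * QQ c (η : EE n) ^ 2 := by
    intro η
    rw [integral_const_mul, integral_congr_ae (Eventually.of_forall fun ω => hDs ω η),
      integral_neg, hD]
    ring
  simp_rw [h2]
  rw [integral_const_mul]
  ring

lemma phi_bound {x : ℝ} (hx : |x| ≤ 1 / 2) :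
    |(1 + x) ^ 2 * Real.log ((1 + x) ^ 2) - 2 * x - 3 * x ^ 2| ≤ 20 * |x| ^ 3 := by
  have h1 := Real.abs_log_sub_add_sum_range_le (x := -x) (by rw [abs_neg]; linarith) 2
  simp only [Finset.sum_range_succ, Finset.sum_range_zero, abs_neg, sub_neg_eq_add] at h1
  norm_num at h1
  set l := Real.log (1 + x) with hl
  have h2 : |x| ^ 3 / (1 - |x|) ≤ 2 * |x| ^ 3 := by
    rw [div_le_iff₀ (by linarith)]
    have : 0 ≤ |x| ^ 3 := by positivity
    nlinarith
  have h3 : |l - (x - x ^ 2 / 2)| ≤ 2 * |x| ^ 3 := by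
    refine le_trans (le_of_eq ?_) (h1.trans h2)
    congr 1; ring
  rw [Real.log_pow, ← hl]
  push_cast
  have e : (1 + x) ^ 2 * (2 * l) - 2 * x - 3 * x ^ 2 =
      2 * (1 + x) ^ 2 * (l - (x - x ^ 2 / 2)) - x ^ 4 := by ring
  rw [e]
  have hb := abs_le.1 hx
  have h4 : |2 * (1 + x) ^ 2| ≤ 9 / 2 := by
    rw [abs_of_nonneg (by positivity)]; nlinarith
  have h5 : |x ^ 4| ≤ |x| ^ 3 := by
    rw [abs_pow, pow_succ]
    exact mul_le_of_le_one_right (by positivity) (by linarith)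
  calc _ ≤ |2 * (1 + x) ^ 2 * (l - (x - x ^ 2 / 2))| + |x ^ 4| := abs_sub _ _
    _ ≤ 9 / 2 * (2 * |x| ^ 3) + |x| ^ 3 := by
      rw [abs_mul]; gcongr
    _ ≤ _ := by nlinarith [show 0 ≤ |x| ^ 3 by positivity]

lemma log_lim {M : ℝ} (hM : 0 < M) :
    Tendsto (fun ε : ℝ => (M + ε ^ 2) * Real.log ((M + ε ^ 2) / M) / ε ^ 2)
      (nhdsWithin 0 {(0 : ℝ)}ᶜ) (nhds 1) := by
  have h1 : HasDerivAt (fun s : ℝ => (M + s) * Real.log ((M + s) / M)) 1 0 := by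
    have ha : HasDerivAt (fun s : ℝ => M + s) 1 0 := (hasDerivAt_id 0).const_add M
    have hb := (ha.div_const M).log (by simp [hM.ne'])
    have := ha.mul hb
    refine this.congr_deriv ?_
    simp [hM.ne']
  have h2 := h1.tendsto_slope_zero
  have h3 : Tendsto (fun ε : ℝ => ε ^ 2) (nhdsWithin 0 {(0 : ℝ)}ᶜ) (nhdsWithin 0 {(0 : ℝ)}ᶜ) := by
    refine tendsto_nhdsWithin_iff.2 ⟨?_, ?_⟩
    · have : Tendsto (fun ε : ℝ => ε ^ 2) (nhds 0) (nhds (0 ^ 2)) :=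
        (continuous_pow 2).tendsto 0
      rw [zero_pow two_ne_zero] at this
      exact this.mono_left nhdsWithin_le_nhds
    · filter_upwards [self_mem_nhdsWithin] with ε hε
      exact pow_ne_zero 2 hε
  refine (h2.comp h3).congr fun ε => ?_
  simp [hM.ne']
  ring

/-- The entropy part of the expansion. -/
lemma entropy_lim {n : ℕ} {Y : Sph n → ℝ} (hYc : Continuous Y)
    {B : ℝ} (hB0 : 0 < B) (hB : ∀ ω, |Y ω| ≤ B)
    (hmean : ∫ ω, Y ω ∂(sphMeasure n) = 0) (hnorm : ∫ ω, Y ω ^ 2 ∂(sphMeasure n) = 1)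
    (hM : 0 < (sphMeasure n Set.univ).toReal) :
    Tendsto (fun ε : ℝ => (∫ ω : Sph n,
      (1 + ε * Y ω) ^ 2 * Real.log ((1 + ε * Y ω) ^ 2 * (sphMeasure n Set.univ).toReal
        / ∫ η : Sph n, (1 + ε * Y η) ^ 2 ∂(sphMeasure n)) ∂(sphMeasure n)) / ε ^ 2)
      (nhdsWithin 0 {(0 : ℝ)}ᶜ) (nhds 2) := by
  set M := (sphMeasure n Set.univ).toReal with hMdef
  have iY := sph_integrable hYc
  have iY2 : Integrable (fun ω => Y ω ^ 2) (sphMeasure n) := sph_integrable (hYc.pow 2)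
  have hN : ∀ ε : ℝ, ∫ η : Sph n, (1 + ε * Y η) ^ 2 ∂(sphMeasure n) = M + ε ^ 2 := by
    intro ε
    have : ∀ η, (1 + ε * Y η) ^ 2 = 1 + ((2 * ε) * Y η + ε ^ 2 * Y η ^ 2) := fun η => by ring
    simp_rw [this]
    have iS : Integrable (fun η => (2 * ε) * Y η + ε ^ 2 * Y η ^ 2) (sphMeasure n) :=
      (iY.const_mul _).add (iY2.const_mul _)
    rw [integral_add (integrable_const _) iS,
      integral_add (iY.const_mul _) (iY2.const_mul _), integral_const_mul, integral_const_mul,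
      hmean, hnorm]
    simp [M, measureReal_def]
  simp_rw [hN]
  let φ : ℝ → ℝ → ℝ := fun ε y => (1 + ε * y) ^ 2 * Real.log ((1 + ε * y) ^ 2)
  have hsmall : ∀ᶠ ε in nhdsWithin (0 : ℝ) {(0 : ℝ)}ᶜ, |ε| * B ≤ 1 / 2 ∧ ε ≠ 0 := by
    have h1 : Tendsto (fun ε : ℝ => |ε| * B) (nhds 0) (nhds (|0| * B)) :=
      Continuous.tendsto (by fun_prop) 0
    rw [abs_zero, zero_mul] at h1
    have h2 := (h1.mono_left (nhdsWithin_le_nhds (s := {(0 : ℝ)}ᶜ))).eventually_le_const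
      (show (0 : ℝ) < 1 / 2 by norm_num)
    filter_upwards [h2, self_mem_nhdsWithin] with ε h3 h4
    exact ⟨h3, h4⟩
  have hx : ∀ ε : ℝ, |ε| * B ≤ 1 / 2 → ∀ ω, |ε * Y ω| ≤ 1 / 2 := by
    intro ε hε ω
    rw [abs_mul]
    exact (mul_le_mul_of_nonneg_left (hB ω) (abs_nonneg _)).trans hε
  have hpos : ∀ ε : ℝ, |ε| * B ≤ 1 / 2 → ∀ ω, 0 < 1 + ε * Y ω := by
    intro ε hε ω
    have := (abs_le.1 (hx ε hε ω)).1
    linarith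
  have hφint : ∀ ε : ℝ, |ε| * B ≤ 1 / 2 → Integrable (fun ω => φ ε (Y ω)) (sphMeasure n) := by
    intro ε hε
    refine sph_integrable ?_
    simp only [φ]
    refine Continuous.mul (by fun_prop) (Continuous.log (by fun_prop) fun ω => ?_)
    exact pow_ne_zero 2 (hpos ε hε ω).ne'
  have hsplit : ∀ ε : ℝ, |ε| * B ≤ 1 / 2 → ∫ ω : Sph n,
      (1 + ε * Y ω) ^ 2 * Real.log ((1 + ε * Y ω) ^ 2 * M / (M + ε ^ 2)) ∂(sphMeasure n) =
      (∫ ω, φ ε (Y ω) ∂(sphMeasure n)) - (M + ε ^ 2) * Real.log ((M + ε ^ 2) / M) := by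
    intro ε hε
    have hMe : 0 < M + ε ^ 2 := by positivity
    have : ∀ ω, (1 + ε * Y ω) ^ 2 * Real.log ((1 + ε * Y ω) ^ 2 * M / (M + ε ^ 2)) =
        φ ε (Y ω) - (1 + ε * Y ω) ^ 2 * Real.log ((M + ε ^ 2) / M) := by
      intro ω
      have hp := hpos ε hε ω
      rw [Real.log_div (by positivity) hMe.ne', Real.log_mul (by positivity) hM.ne',
        Real.log_div hMe.ne' hM.ne']
      simp only [φ]; ring
    simp_rw [this]
    rw [integral_sub (hφint ε hε) ((sph_integrable (by fun_prop)).mul_const _),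
      integral_mul_const, hN]
  have hφlim : Tendsto (fun ε : ℝ => (∫ ω, φ ε (Y ω) ∂(sphMeasure n)) / ε ^ 2)
      (nhdsWithin 0 {(0 : ℝ)}ᶜ) (nhds 3) := by
    have hbound : ∀ᶠ ε in nhdsWithin (0 : ℝ) {(0 : ℝ)}ᶜ,
        ‖(∫ ω, φ ε (Y ω) ∂(sphMeasure n)) / ε ^ 2 - 3‖ ≤ (20 * B ^ 3 * M) * |ε| := by
      filter_upwards [hsmall] with ε hε
      obtain ⟨hε, hε0⟩ := hε
      have e1 : (∫ ω, φ ε (Y ω) ∂(sphMeasure n)) - 3 * ε ^ 2 =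
          ∫ ω, (φ ε (Y ω) - 2 * (ε * Y ω) - 3 * (ε * Y ω) ^ 2) ∂(sphMeasure n) := by
        have : ∀ ω, φ ε (Y ω) - 2 * (ε * Y ω) - 3 * (ε * Y ω) ^ 2 =
            φ ε (Y ω) - ((2 * ε) * Y ω + (3 * ε ^ 2) * Y ω ^ 2) := fun ω => by ring
        simp_rw [this]
        have iS : Integrable (fun η => (2 * ε) * Y η + (3 * ε ^ 2) * Y η ^ 2) (sphMeasure n) :=
          (iY.const_mul _).add (iY2.const_mul _)
        rw [integral_sub (hφint ε hε) iS,
          integral_add (iY.const_mul _) (iY2.const_mul _), integral_const_mul,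
          integral_const_mul, hmean, hnorm]
        ring
      have e2 : |(∫ ω, φ ε (Y ω) ∂(sphMeasure n)) - 3 * ε ^ 2| ≤ 20 * (|ε| * B) ^ 3 * M := by
        rw [e1]
        suffices hb : ∀ ω, ‖φ ε (Y ω) - 2 * (ε * Y ω) - 3 * (ε * Y ω) ^ 2‖ ≤ 20 * (|ε| * B) ^ 3 by
          exact norm_integral_le_of_norm_le_const (μ := sphMeasure n)
            (f := fun ω => φ ε (Y ω) - 2 * (ε * Y ω) - 3 * (ε * Y ω) ^ 2)
            (C := 20 * (|ε| * B) ^ 3) (Eventually.of_forall hb)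
        intro ω
        refine (phi_bound (hx ε hε ω)).trans ?_
        rw [abs_mul]
        have := hB ω
        gcongr
      have hε2 : 0 < ε ^ 2 := by positivity
      rw [show (∫ ω, φ ε (Y ω) ∂(sphMeasure n)) / ε ^ 2 - 3 =
        ((∫ ω, φ ε (Y ω) ∂(sphMeasure n)) - 3 * ε ^ 2) / ε ^ 2 by field_simp,
        Real.norm_eq_abs, abs_div, abs_of_pos hε2, div_le_iff₀ hε2]
      refine e2.trans (le_of_eq ?_)
      rw [← sq_abs ε]; ring
    have hz : Tendsto (fun ε : ℝ => (20 * B ^ 3 * M) * |ε|) (nhdsWithin 0 {(0 : ℝ)}ᶜ) (nhds 0) := by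
      have h1 : Tendsto (fun ε : ℝ => (20 * B ^ 3 * M) * |ε|) (nhds 0)
          (nhds ((20 * B ^ 3 * M) * |0|)) := Continuous.tendsto (by fun_prop) 0
      rw [abs_zero, mul_zero] at h1
      exact h1.mono_left nhdsWithin_le_nhds
    exact tendsto_sub_nhds_zero_iff.1 (squeeze_zero_norm' hbound hz)
  have := hφlim.sub (log_lim hM)
  rw [show (3 : ℝ) - 1 = 2 by norm_num] at this
  refine this.congr' ?_
  filter_upwards [hsmall] with ε hε
  rw [hsplit ε hε.1]
  ring

/-- for any `L²`-normalized degree-2 spherical harmonic `Y` on `S^n`,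
`LS(1 + εY) = (8π^{n/2}/(Γ(n/2)(n+2)))·ε² + o(ε²)` as `ε → 0`. -/
theorem LS_expansion_degree_two (n : ℕ) (hn : 1 ≤ n)
    (Y : Sph n → ℝ) (hY : IsSphericalHarmonic 2 Y)
    (hnorm : ∫ ω : Sph n, (Y ω) ^ 2 ∂(sphMeasure n) = 1) :
    Tendsto (fun ε : ℝ =>
        (LSfun n (fun ω => 1 + ε * Y ω)
          - (8 * π ^ ((n : ℝ) / 2) / (Real.Gamma ((n : ℝ) / 2) * ((n : ℝ) + 2))) * ε ^ 2)
          / ε ^ 2)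
      (nhdsWithin 0 {(0 : ℝ)}ᶜ) (nhds 0) := by
  obtain ⟨P, hP, hl, hYP⟩ := hY
  obtain ⟨c, hc, hPc⟩ := poly_QQ P hP hl
  have hYc : Y = fun ω : Sph n => QQ c (ω : EE n) := by
    ext ω; rw [hYP, ← hPc]
  have hcont : Continuous Y := by rw [hYc]; exact QQ_cont c
  obtain ⟨B, hB0, hB⟩ := QQ_bdd c
  have hB' : ∀ ω, |Y ω| ≤ B := by rw [hYc]; exact hB
  have hmean : ∫ ω, Y ω ∂(sphMeasure n) = 0 := by rw [hYc]; exact QQ_mean hn c hc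
  have hM : 0 < (sphMeasure n Set.univ).toReal := by
    refine ENNReal.toReal_pos ?_ (measure_ne_top _ _)
    rw [Ne, Measure.measure_univ_eq_zero]
    exact Measure.toSphere_ne_zero _
  have hent := entropy_lim hcont hB0 hB' hmean hnorm hM
  have hen : ∫ ω : Sph n, ∫ η : Sph n, (Y ω - Y η) ^ 2 /
      ‖(ω : EE n) - (η : EE n)‖ ^ n ∂(sphMeasure n) ∂(sphMeasure n) = 2 * lam n := by
    rw [hYc] at hnorm ⊢
    have := QQ_energy hn c hc
    rw [hnorm, mul_one] at this
    exact this
  have hen2 : ∀ ε : ℝ, ∫ ω : Sph n, ∫ η : Sph n, ((1 + ε * Y ω) - (1 + ε * Y η)) ^ 2 /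
      ‖(ω : EE n) - (η : EE n)‖ ^ n ∂(sphMeasure n) ∂(sphMeasure n) = ε ^ 2 * (2 * lam n) := by
    intro ε
    rw [← hen]
    simp_rw [← integral_const_mul]
    congr 1; ext ω; congr 1; ext η
    ring
  have h0 : 2 * lam n - Cls n * 2 - Jc n = 0 := by
    unfold lam Cls Jc
    have hn0 : (0 : ℝ) < n := by exact_mod_cast hn
    have := (Real.Gamma_pos_of_pos (show (0 : ℝ) < n / 2 by positivity)).ne'
    field_simp
    ring
  have hlim := ((tendsto_const_nhds (x := 2 * lam n)).sub (hent.const_mul (Cls n))).sub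
    (tendsto_const_nhds (x := Jc n))
  rw [h0] at hlim
  refine hlim.congr' ?_
  filter_upwards [self_mem_nhdsWithin] with ε hε
  have hε0 : ε ≠ 0 := hε
  unfold LSfun
  rw [hen2]
  change _ = (_ - Jc n * ε ^ 2) / ε ^ 2
  have h2 := pow_ne_zero 2 hε0
  rw [eq_div_iff h2, sub_mul, sub_mul, mul_assoc (Cls n), div_mul_cancel₀ _ h2]
  ring
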